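/- Assume W is a double-well potential (W ∈ C¹(ℝ), W(-1) = W(1) = 0, W(s) > 0 for s ≠ ±1) and a : ℝ → ℝ satisfies 0 < a₁ ≤ a(t) ≤ a₂ for all t ∈ ℝ and lim_{|t|→∞} a(t) = a₂. Then L_a attains its infimum at some u_a ∈ X₁; moreover, u_a is a C¹ ∩ W^{2,2}_loc solution of (u'/√(1 − |u'|²))' = a(t) W'(u) on ℝ with lim_{t→±∞}(u(t), u'(t)) = (±1, 0), and ‖u_a'‖_{L^∞(ℝ)} < 1. -/

import Mathlib

open MeasureTheory Filter Topology Set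
open scoped ENNReal

noncomputable section

/-- The class `X₁`: `W^{1,∞}(ℝ)` functions with `‖u'‖_{L^∞} ≤ 1` and `u(t) → ±1` as
`t → ±∞`. -/
def memX1 (u : ℝ → ℝ) : Prop :=
  LipschitzWith 1 u ∧ Tendsto u atTop (𝓝 (1:ℝ)) ∧ Tendsto u atBot (𝓝 (-1:ℝ))

/-- `W` is a double-well potential: `C¹`, vanishing exactly at `±1` and positive elsewhere. -/
def DoubleWell (W : ℝ → ℝ) : Prop :=
  ContDiff ℝ 1 W ∧ W (-1) = 0 ∧ W 1 = 0 ∧ ∀ s : ℝ, s ≠ -1 → s ≠ 1 → 0 < W s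

/-- The action functional `L_a(u) = ∫_ℝ (1 - √(1 - |u'|²) + a(t) W(u)) dt`. -/
def LaE (a W u : ℝ → ℝ) : ℝ≥0∞ :=
  ∫⁻ t : ℝ, ENNReal.ofReal (1 - Real.sqrt (1 - (deriv u t) ^ 2) + a t * W (u t))

/-- `u` is a `C¹ ∩ W^{2,2}_loc` solution of `(u'/√(1-|u'|²))' = a(t) W'(u)` on `ℝ`,
expressed through the integrated form of the equation. -/
def SolvesEL (a W u : ℝ → ℝ) : Prop :=
  ContDiff ℝ 1 u ∧
  ∀ s t : ℝ,
    deriv u t / Real.sqrt (1 - (deriv u t) ^ 2)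
      - deriv u s / Real.sqrt (1 - (deriv u s) ^ 2)
    = ∫ r in s..t, a r * deriv W (u r)

/-- The kinetic part `p ↦ 1 - √(1 - p²)` of the Lagrangian. -/
def kin (p : ℝ) : ℝ := 1 - Real.sqrt (1 - p ^ 2)

lemma kin_nonneg (p : ℝ) : 0 ≤ kin p := by
  have : Real.sqrt (1 - p ^ 2) ≤ 1 := Real.sqrt_le_one.2 (by nlinarith [sq_nonneg p])
  unfold kin; linarith

lemma kin_le_one (p : ℝ) : kin p ≤ 1 := by
  have := Real.sqrt_nonneg (1 - p ^ 2)
  unfold kin; linarith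

@[simp] lemma kin_zero : kin 0 = 0 := by simp [kin]

lemma continuous_kin : Continuous kin := by unfold kin; fun_prop

lemma convexOn_kin : ConvexOn ℝ (Icc (-1) 1) kin := by
  refine ⟨convex_Icc _ _, ?_⟩
  intro x hx y hy s t hs ht hst
  simp only [smul_eq_mul, kin]
  have hx2 : 0 ≤ 1 - x ^ 2 := by nlinarith [hx.1, hx.2]
  have hy2 : 0 ≤ 1 - y ^ 2 := by nlinarith [hy.1, hy.2]
  have h1 := Real.sq_sqrt hx2
  have h2 := Real.sq_sqrt hy2
  have key : s * Real.sqrt (1 - x ^ 2) + t * Real.sqrt (1 - y ^ 2)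
      ≤ Real.sqrt (1 - (s * x + t * y) ^ 2) := by
    apply Real.le_sqrt_of_sq_le
    obtain rfl : t = 1 - s := by linarith
    nlinarith [mul_nonneg (mul_nonneg hs ht)
      (add_nonneg (sq_nonneg (Real.sqrt (1 - x ^ 2) - Real.sqrt (1 - y ^ 2)))
        (sq_nonneg (x - y)))]
  linarith

lemma LipschitzWith.abs_deriv_le_one {u : ℝ → ℝ} (hu : LipschitzWith 1 u) (t : ℝ) :
    |deriv u t| ≤ 1 := by
  simpa using norm_deriv_le_of_lipschitz (x₀ := t) hu

lemma LipschitzWith.abs_sub_le_abs_sub {u : ℝ → ℝ} (hu : LipschitzWith 1 u) (s t : ℝ) :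
    |u s - u t| ≤ |s - t| := by
  simpa [Real.dist_eq] using hu.dist_le_mul s t

lemma lipschitzWith_one_of_abs {u : ℝ → ℝ} (hu : ∀ s t, |u s - u t| ≤ |s - t|) :
    LipschitzWith 1 u :=
  LipschitzWith.of_dist_le_mul fun s t => by simpa [Real.dist_eq] using hu s t

lemma DoubleWell.continuous {W : ℝ → ℝ} (hW : DoubleWell W) : Continuous W :=
  hW.1.continuous

lemma DoubleWell.nonneg {W : ℝ → ℝ} (hW : DoubleWell W) (s : ℝ) : 0 ≤ W s := by
  by_cases h1 : s = -1
  · rw [h1, hW.2.1]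
  by_cases h2 : s = 1
  · rw [h2, hW.2.2.1]
  exact (hW.2.2.2 s h1 h2).le

/-- The integrand of the action is `kin (u') + a W(u)`. -/
lemma LaE_eq (a W u : ℝ → ℝ) :
    LaE a W u = ∫⁻ t : ℝ, ENNReal.ofReal (kin (deriv u t) + a t * W (u t)) := rfl

lemma intervalIntegrable_deriv_of_lipschitz {u : ℝ → ℝ} (hu : LipschitzWith 1 u) (s t : ℝ) :
    IntervalIntegrable (deriv u) volume s t :=
  (hu.lipschitzOnWith (s := uIcc s t)).absolutelyContinuousOnInterval.intervalIntegrable_deriv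

lemma integral_deriv_of_lipschitz {u : ℝ → ℝ} (hu : LipschitzWith 1 u) (s t : ℝ) :
    ∫ x in s..t, deriv u x = u t - u s :=
  (hu.lipschitzOnWith (s := uIcc s t)).absolutelyContinuousOnInterval.integral_deriv_eq_sub

lemma integrableOn_of_bdd {f : ℝ → ℝ} (hf : Measurable f) {C : ℝ} (hC : ∀ x, |f x| ≤ C)
    (S : Set ℝ) (hS : volume S ≠ ⊤) : IntegrableOn f S :=
  Measure.integrableOn_of_bounded hS hf.aestronglyMeasurable
    (Eventually.of_forall fun x => by simpa using hC x)

/-- Jensen's inequality for a difference quotient of a `1`-Lipschitz function. -/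
lemma kin_diffQuot_le {u : ℝ → ℝ} (hu : LipschitzWith 1 u) {h : ℝ} (hh : 0 < h) (t : ℝ) :
    ENNReal.ofReal (kin ((u (t + h) - u t) / h))
      ≤ ∫⁻ r in Ioc (0:ℝ) 1, ENNReal.ofReal (kin (deriv u (t + h * r))) := by
  have hP : IsProbabilityMeasure (volume.restrict (Ioc (0:ℝ) 1)) := ⟨by simp⟩
  have hm : Measurable fun r => deriv u (t + h * r) :=
    (measurable_deriv u).comp (by fun_prop)
  have hmk : Measurable fun r => kin (deriv u (t + h * r)) := continuous_kin.measurable.comp hm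
  have hi1 : IntegrableOn (fun r => deriv u (t + h * r)) (Ioc (0:ℝ) 1) :=
    integrableOn_of_bdd hm (C := 1) (fun r => hu.abs_deriv_le_one _) _ (by simp)
  have hi2 : IntegrableOn (fun r => kin (deriv u (t + h * r))) (Ioc (0:ℝ) 1) :=
    integrableOn_of_bdd hmk (C := 1)
      (fun r => abs_le.2 ⟨by linarith [kin_nonneg (deriv u (t + h * r))], kin_le_one _⟩)
      _ (by simp)
  have hJ := convexOn_kin.map_integral_le (μ := volume.restrict (Ioc (0:ℝ) 1))
    continuous_kin.continuousOn isClosed_Icc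
    (f := fun r => deriv u (t + h * r))
    (Eventually.of_forall fun r => abs_le.1 (hu.abs_deriv_le_one _)) hi1 hi2
  have heq : ∫ r in Ioc (0:ℝ) 1, deriv u (t + h * r) = (u (t + h) - u t) / h := by
    rw [← intervalIntegral.integral_of_le zero_le_one,
      intervalIntegral.integral_comp_add_mul _ hh.ne', integral_deriv_of_lipschitz hu]
    simp [div_eq_inv_mul]
  rw [heq] at hJ
  rw [← ofReal_integral_eq_lintegral_ofReal hi2 (Eventually.of_forall fun r => kin_nonneg _)]
  exact ENNReal.ofReal_le_ofReal hJ

lemma lintegral_kin_diffQuot_le {u : ℝ → ℝ} (hu : LipschitzWith 1 u) {h : ℝ} (hh : 0 < h) :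
    ∫⁻ t, ENNReal.ofReal (kin ((u (t + h) - u t) / h))
      ≤ ∫⁻ t, ENNReal.ofReal (kin (deriv u t)) := by
  have hm : Measurable fun t => ENNReal.ofReal (kin (deriv u t)) :=
    (continuous_kin.measurable.comp (measurable_deriv u)).ennreal_ofReal
  calc ∫⁻ t, ENNReal.ofReal (kin ((u (t + h) - u t) / h))
      ≤ ∫⁻ t, ∫⁻ r in Ioc (0:ℝ) 1, ENNReal.ofReal (kin (deriv u (t + h * r))) :=
        lintegral_mono fun t => kin_diffQuot_le hu hh t
    _ = ∫⁻ r in Ioc (0:ℝ) 1, ∫⁻ t, ENNReal.ofReal (kin (deriv u (t + h * r))) := by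
        refine lintegral_lintegral_swap ?_
        exact (hm.comp (by fun_prop : Measurable fun p : ℝ × ℝ => p.1 + h * p.2)).aemeasurable
    _ = ∫⁻ r in Ioc (0:ℝ) 1, ∫⁻ t, ENNReal.ofReal (kin (deriv u t)) := by
        refine lintegral_congr fun r => ?_
        exact lintegral_add_right_eq_self (fun t => ENNReal.ofReal (kin (deriv u t))) (h * r)
    _ = ∫⁻ t, ENNReal.ofReal (kin (deriv u t)) := by simp

lemma lintegral_diffQuot_le_LaE {a W u : ℝ → ℝ} (hW : Continuous W) (hW0 : ∀ s, 0 ≤ W s)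
    (hma : Measurable a) (ha : ∀ t, 0 ≤ a t) (hu : LipschitzWith 1 u) {h : ℝ} (hh : 0 < h) :
    ∫⁻ t, ENNReal.ofReal (kin ((u (t + h) - u t) / h) + a t * W (u t)) ≤ LaE a W u := by
  have hpot : ∀ t, 0 ≤ a t * W (u t) := fun t => mul_nonneg (ha t) (hW0 _)
  have hmp : Measurable fun t => ENNReal.ofReal (a t * W (u t)) :=
    (hma.mul (hW.measurable.comp hu.continuous.measurable)).ennreal_ofReal
  rw [LaE_eq]
  simp_rw [fun t => ENNReal.ofReal_add (kin_nonneg ((u (t + h) - u t) / h)) (hpot t),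
    fun t => ENNReal.ofReal_add (kin_nonneg (deriv u t)) (hpot t)]
  rw [lintegral_add_right _ hmp, lintegral_add_right _ hmp]
  exact add_le_add (lintegral_kin_diffQuot_le hu hh) le_rfl

/-- Lower semicontinuity of the action under pointwise convergence of `1`-Lipschitz functions
and of the weights. -/
lemma LaE_le_of_tendsto {W : ℝ → ℝ} (hW : Continuous W) (hW0 : ∀ s, 0 ≤ W s)
    {α : ℕ → ℝ → ℝ} {α' : ℝ → ℝ} {v : ℕ → ℝ → ℝ} {u : ℝ → ℝ}
    (hmα : ∀ n, Measurable (α n)) (hα : ∀ n t, 0 ≤ α n t)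
    (hαlim : ∀ t, Tendsto (fun n => α n t) atTop (𝓝 (α' t)))
    (hv : ∀ n, LipschitzWith 1 (v n)) (hu : LipschitzWith 1 u)
    (hlim : ∀ t, Tendsto (fun n => v n t) atTop (𝓝 (u t)))
    {c : ℕ → ℝ≥0∞} {m : ℝ≥0∞} (hc : ∀ n, LaE (α n) W (v n) ≤ c n)
    (hcm : Tendsto c atTop (𝓝 m)) : LaE α' W u ≤ m := by
  have hmα' : Measurable α' := measurable_of_tendsto_metrizable hmα (tendsto_pi_nhds.2 hαlim)
  have hmeas : ∀ {a w : ℝ → ℝ} (h : ℝ), Measurable a → LipschitzWith 1 w →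
      Measurable fun t => ENNReal.ofReal (kin ((w (t + h) - w t) / h) + a t * W (w t)) := by
    intro a w h hma hw
    have hwc := hw.continuous
    have h1 : Continuous fun t => kin ((w (t + h) - w t) / h) :=
      continuous_kin.comp (by fun_prop)
    have h2 : Continuous fun t => W (w t) := hW.comp hwc
    exact (h1.measurable.add (hma.mul h2.measurable)).ennreal_ofReal
  have step : ∀ h : ℝ, 0 < h →
      ∫⁻ t, ENNReal.ofReal (kin ((u (t + h) - u t) / h) + α' t * W (u t)) ≤ m := by
    intro h hh
    have hpt : ∀ t, Tendsto (fun n => ENNReal.ofReal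
        (kin ((v n (t + h) - v n t) / h) + α n t * W (v n t))) atTop
        (𝓝 (ENNReal.ofReal (kin ((u (t + h) - u t) / h) + α' t * W (u t)))) := by
      intro t
      refine ENNReal.tendsto_ofReal (Tendsto.add ?_ ?_)
      · exact (continuous_kin.tendsto _).comp (((hlim _).sub (hlim _)).div_const h)
      · exact (hαlim t).mul ((hW.tendsto _).comp (hlim t))
    calc ∫⁻ t, ENNReal.ofReal (kin ((u (t + h) - u t) / h) + α' t * W (u t))
        = ∫⁻ t, liminf (fun n => ENNReal.ofReal
            (kin ((v n (t + h) - v n t) / h) + α n t * W (v n t))) atTop :=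
          lintegral_congr fun t => ((hpt t).liminf_eq).symm
      _ ≤ liminf (fun n => ∫⁻ t, ENNReal.ofReal
            (kin ((v n (t + h) - v n t) / h) + α n t * W (v n t))) atTop :=
          lintegral_liminf_le fun n => hmeas h (hmα n) (hv n)
      _ ≤ liminf c atTop := by
          refine liminf_le_liminf (Eventually.of_forall fun n => ?_)
          exact (lintegral_diffQuot_le_LaE hW hW0 (hmα n) (hα n) (hv n) hh).trans (hc n)
      _ = m := hcm.liminf_eq
  have hk : Tendsto (fun k : ℕ => (1:ℝ) / (k + 1)) atTop (𝓝 0) :=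
    tendsto_one_div_add_atTop_nhds_zero_nat
  have hk0 : ∀ k : ℕ, (0:ℝ) < 1 / (k + 1) := fun k => by positivity
  have hae : ∀ᵐ t, Tendsto (fun k : ℕ => ENNReal.ofReal
      (kin ((u (t + 1 / (k + 1)) - u t) / (1 / (k + 1))) + α' t * W (u t))) atTop
      (𝓝 (ENNReal.ofReal (kin (deriv u t) + α' t * W (u t)))) := by
    filter_upwards [hu.ae_differentiableAt_real] with t ht
    refine ENNReal.tendsto_ofReal (Tendsto.add ?_ tendsto_const_nhds)
    refine (continuous_kin.tendsto _).comp ?_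
    have h1 := (hasDerivAt_iff_tendsto_slope_zero.1 ht.hasDerivAt).comp
      (tendsto_nhdsWithin_iff.2 ⟨hk, Eventually.of_forall fun k => (hk0 k).ne'⟩)
    refine h1.congr fun k => ?_
    simp [div_eq_inv_mul]
  rw [LaE_eq]
  calc ∫⁻ t, ENNReal.ofReal (kin (deriv u t) + α' t * W (u t))
      = ∫⁻ t, liminf (fun k : ℕ => ENNReal.ofReal
          (kin ((u (t + 1 / (k + 1)) - u t) / (1 / (k + 1))) + α' t * W (u t))) atTop :=
        lintegral_congr_ae (by filter_upwards [hae] with t ht using ht.liminf_eq.symm)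
    _ ≤ liminf (fun k : ℕ => ∫⁻ t, ENNReal.ofReal
          (kin ((u (t + 1 / (k + 1)) - u t) / (1 / (k + 1))) + α' t * W (u t))) atTop :=
        lintegral_liminf_le fun k => hmeas _ hmα' hu
    _ ≤ liminf (fun _ : ℕ => m) atTop :=
        liminf_le_liminf (Eventually.of_forall fun k => step _ (hk0 k))
    _ = m := by simp

lemma lipschitzWith_glue {f g : ℝ → ℝ} {s : ℝ} (hf : LipschitzWith 1 f) (hg : LipschitzWith 1 g)
    (hfg : f s = g s) : LipschitzWith 1 (fun t => if t ≤ s then f t else g t) := by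
  have mixed : ∀ t t', t ≤ s → s < t' → |f t - g t'| ≤ |t - t'| := by
    intro t t' ht ht'
    have h1 := hf.abs_sub_le_abs_sub t s
    have h2 := hg.abs_sub_le_abs_sub s t'
    rw [abs_of_nonpos (by linarith : t - s ≤ 0)] at h1
    rw [abs_of_nonpos (by linarith : s - t' ≤ 0)] at h2
    rw [abs_of_nonpos (by linarith : t - t' ≤ 0)]
    calc |f t - g t'| = |(f t - f s) + (g s - g t')| := by rw [hfg]; congr 1; ring
      _ ≤ -(t - t') := (abs_add_le _ _).trans (by linarith)
  refine lipschitzWith_one_of_abs fun t t' => ?_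
  by_cases ht : t ≤ s <;> by_cases ht' : t' ≤ s <;> simp only [ht, ht', if_true, if_false]
  · exact hf.abs_sub_le_abs_sub t t'
  · exact mixed t t' ht (not_le.1 ht')
  · rw [abs_sub_comm, abs_sub_comm t]
    exact mixed t' t ht' (not_le.1 ht)
  · exact hg.abs_sub_le_abs_sub t t'

lemma deriv_glue_of_gt {f g : ℝ → ℝ} {s t : ℝ} (ht : s < t) :
    deriv (fun t => if t ≤ s then f t else g t) t = deriv g t := by
  refine EventuallyEq.deriv_eq ?_
  filter_upwards [Ioi_mem_nhds ht] with x hx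
  exact if_neg (not_le.2 hx)

lemma LaE_mono_weight {a b W u : ℝ → ℝ} (hW0 : ∀ s, 0 ≤ W s) (hab : ∀ t, a t ≤ b t) :
    LaE a W u ≤ LaE b W u := by
  simp_rw [LaE_eq]
  refine lintegral_mono fun t => ENNReal.ofReal_le_ofReal ?_
  have := mul_le_mul_of_nonneg_right (hab t) (hW0 (u t))
  linarith

lemma LaE_reflect (a W u : ℝ → ℝ) :
    LaE (fun t => a (-t)) (fun s => W (-s)) (fun t => -u (-t)) = LaE a W u := by
  have h : ∀ t, deriv (fun t => -u (-t)) t = deriv u (-t) := by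
    intro t
    rw [deriv.fun_neg, deriv_comp_neg, neg_neg]
  simp_rw [LaE_eq, h, neg_neg]
  exact lintegral_neg_eq_self (μ := volume)
    (fun t => ENNReal.ofReal (kin (deriv u t) + a t * W (u t)))

lemma LaE_translate (a W u : ℝ → ℝ) (b : ℝ) :
    LaE (fun t => a (t + b)) W (fun t => u (t + b)) = LaE a W u := by
  simp_rw [LaE_eq, deriv_comp_add_const]
  exact lintegral_add_right_eq_self
    (fun t => ENNReal.ofReal (kin (deriv u t) + a t * W (u t))) b

lemma memX1.reflect {u : ℝ → ℝ} (hu : memX1 u) : memX1 (fun t => -u (-t)) := by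
  refine ⟨lipschitzWith_one_of_abs fun s t => ?_, ?_, ?_⟩
  · have := hu.1.abs_sub_le_abs_sub (-t) (-s)
    rwa [show -t - -s = s - t by ring, show u (-t) - u (-s) = -u (-s) - -u (-t) by ring] at this
  · simpa using (hu.2.2.comp tendsto_neg_atTop_atBot).neg
  · exact (hu.2.1.comp tendsto_neg_atBot_atTop).neg

lemma memX1.translate {u : ℝ → ℝ} (hu : memX1 u) (b : ℝ) : memX1 (fun t => u (t + b)) := by
  refine ⟨lipschitzWith_one_of_abs fun s t => ?_, ?_, ?_⟩
  · simpa using hu.1.abs_sub_le_abs_sub (s + b) (t + b)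
  · exact hu.2.1.comp (tendsto_atTop_add_const_right _ _ tendsto_id)
  · exact hu.2.2.comp (tendsto_atBot_add_const_right _ _ tendsto_id)

lemma DoubleWell.reflect {W : ℝ → ℝ} (hW : DoubleWell W) : DoubleWell (fun s => W (-s)) := by
  refine ⟨hW.1.comp contDiff_neg, by simpa using hW.2.2.1, by simpa using hW.2.1,
    fun s h1 h2 => hW.2.2.2 _ (fun h => h2 (by linarith)) (fun h => h1 (by linarith))⟩

lemma DoubleWell.exists_pos_le {W : ℝ → ℝ} (hW : DoubleWell W) {p q : ℝ} (hp : -1 < p)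
    (hq : q < 1) : ∃ c > 0, ∀ x ∈ Icc p q, c ≤ W x := by
  rcases (Icc p q).eq_empty_or_nonempty with h | h
  · exact ⟨1, one_pos, by simp [h]⟩
  · obtain ⟨x, hx, hmin⟩ := isCompact_Icc.exists_isMinOn h hW.continuous.continuousOn
    exact ⟨W x, hW.2.2.2 x (by linarith [hx.1]) (by linarith [hx.2]), fun y hy => hmin hy⟩

/-- Truncation to `[-1, 1]` stays in `X₁` and does not increase the action. -/
lemma memX1.exists_truncate {a W v : ℝ → ℝ} (hW : DoubleWell W) (ha : ∀ t, 0 ≤ a t)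
    (hv : memX1 v) : ∃ u, memX1 u ∧ (∀ t, |u t| ≤ 1) ∧ LaE a W u ≤ LaE a W v := by
  have hcont := hv.1.continuous
  refine ⟨fun t => max (-1) (min 1 (v t)), ⟨?_, ?_, ?_⟩, fun t => ?_, ?_⟩
  · simpa using (hv.1.const_min 1).const_max (-1)
  · simpa using ((tendsto_const_nhds (x := (1:ℝ))).min hv.2.1).max
      (tendsto_const_nhds (x := (-1:ℝ))) |>.congr fun t => max_comm _ _
  · simpa using ((tendsto_const_nhds (x := (1:ℝ))).min hv.2.2).max
      (tendsto_const_nhds (x := (-1:ℝ))) |>.congr fun t => max_comm _ _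
  · exact abs_le.2 ⟨le_max_left _ _, max_le (by norm_num) (min_le_left _ _)⟩
  · simp_rw [LaE_eq]
    refine lintegral_mono fun t => ENNReal.ofReal_le_ofReal ?_
    have hnn : 0 ≤ kin (deriv v t) + a t * W (v t) :=
      add_nonneg (kin_nonneg _) (mul_nonneg (ha t) (hW.nonneg _))
    rcases le_or_gt 1 (v t) with h1 | h1
    · have hval : max (-1) (min 1 (v t)) = 1 := by rw [min_eq_left h1]; norm_num
      have hd : deriv (fun t => max (-1) (min 1 (v t))) t = 0 := by
        refine IsLocalMax.deriv_eq_zero (Eventually.of_forall fun x => ?_)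
        simp only [hval]
        exact max_le (by norm_num) (min_le_left _ _)
      rw [hval, hd, hW.2.2.1]
      simpa using hnn
    rcases le_or_gt (v t) (-1) with h2 | h2
    · have hval : max (-1) (min 1 (v t)) = -1 := by
        rw [min_eq_right (by linarith), max_eq_left h2]
      have hd : deriv (fun t => max (-1) (min 1 (v t))) t = 0 := by
        refine IsLocalMin.deriv_eq_zero (Eventually.of_forall fun x => ?_)
        simp only [hval]
        exact le_max_left _ _
      rw [hval, hd, hW.2.1]
      simpa using hnn
    · have hev : (fun t => max (-1) (min 1 (v t))) =ᶠ[𝓝 t] v := by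
        filter_upwards [hcont.continuousAt.eventually_lt continuousAt_const h1,
          continuousAt_const.eventually_lt hcont.continuousAt h2] with x hx1 hx2
        rw [min_eq_right hx1.le, max_eq_right hx2.le]
      rw [hev.deriv_eq, hev.eq_of_nhds]

lemma LaE_setLIntegral_le {a W v : ℝ → ℝ} {a₂ K : ℝ} (hK : ∀ x ∈ Icc (-1:ℝ) 1, W x ≤ K)
    (hW0 : ∀ s, 0 ≤ W s)
    (ha : ∀ t, a t ≤ a₂) (ha0 : ∀ t, 0 ≤ a t) (hv : ∀ t, |v t| ≤ 1) (S : Set ℝ) {p q : ℝ}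
    (hzero : ∀ t ∈ S, t ∉ Icc p q → deriv v t = 0 ∧ W (v t) = 0) (hS : MeasurableSet S) :
    ∫⁻ t in S, ENNReal.ofReal (kin (deriv v t) + a t * W (v t))
      ≤ ENNReal.ofReal (1 + a₂ * K) * ENNReal.ofReal (q - p) := by
  calc ∫⁻ t in S, ENNReal.ofReal (kin (deriv v t) + a t * W (v t))
      ≤ ∫⁻ t in S, (Icc p q).indicator (fun _ => ENNReal.ofReal (1 + a₂ * K)) t := by
        refine setLIntegral_mono' hS fun t ht => ?_
        by_cases h : t ∈ Icc p q
        · rw [indicator_of_mem h]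
          refine ENNReal.ofReal_le_ofReal (add_le_add (kin_le_one _) ?_)
          exact mul_le_mul (ha t) (hK _ (abs_le.1 (hv t))) (hW0 _) ((ha0 t).trans (ha t))
        · rw [(hzero t ht h).1, (hzero t ht h).2]
          simp
    _ ≤ ∫⁻ t, (Icc p q).indicator (fun _ => ENNReal.ofReal (1 + a₂ * K)) t :=
        setLIntegral_le_lintegral _ _
    _ = _ := by rw [lintegral_indicator measurableSet_Icc, setLIntegral_const, Real.volume_Icc]

lemma exists_memX1_LaE_ne_top {a W : ℝ → ℝ} {a₂ : ℝ} (hW : DoubleWell W) (ha0 : ∀ t, 0 ≤ a t)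
    (ha : ∀ t, a t ≤ a₂) : ∃ u, memX1 u ∧ LaE a W u ≠ ⊤ := by
  obtain ⟨K, hK⟩ := isCompact_Icc.bddAbove_image (K := Icc (-1:ℝ) 1) hW.continuous.continuousOn
  have hK' : ∀ x ∈ Icc (-1:ℝ) 1, W x ≤ K := fun x hx => hK (mem_image_of_mem _ hx)
  have hvtop : ∀ t : ℝ, 1 ≤ t → max (-1) (min 1 t) = 1 := fun t ht => by
    rw [min_eq_left ht]; norm_num
  have hvbot : ∀ t : ℝ, t ≤ -1 → max (-1) (min 1 t) = -1 := fun t ht => by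
    rw [min_eq_right (by linarith), max_eq_left ht]
  refine ⟨fun t => max (-1) (min 1 t), ⟨?_, ?_, ?_⟩, ?_⟩
  · simpa using (LipschitzWith.id.const_min (1:ℝ)).const_max (-1)
  · exact tendsto_const_nhds.congr' (by
      filter_upwards [eventually_ge_atTop 1] with t ht using (hvtop t ht).symm)
  · exact tendsto_const_nhds.congr' (by
      filter_upwards [eventually_le_atBot (-1)] with t ht using (hvbot t ht).symm)
  · have h := LaE_setLIntegral_le (v := fun t => max (-1) (min 1 t)) hK' hW.nonneg ha ha0
      (fun t => abs_le.2 ⟨le_max_left _ _, max_le (by norm_num) (min_le_left _ _)⟩) univ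
      (p := -1) (q := 1) ?_ MeasurableSet.univ
    · rw [setLIntegral_univ] at h
      rw [LaE_eq]
      exact ne_top_of_le_ne_top (ENNReal.mul_ne_top ENNReal.ofReal_ne_top ENNReal.ofReal_ne_top) h
    · intro t _ ht
      rw [mem_Icc, not_and_or, not_le, not_le] at ht
      rcases ht with ht | ht
      · have hev : (fun t : ℝ => max (-1) (min 1 t)) =ᶠ[𝓝 t] fun _ => -1 := by
          filter_upwards [Iio_mem_nhds ht] with x hx using hvbot x (le_of_lt hx)
        rw [hev.deriv_eq, hev.eq_of_nhds]
        exact ⟨deriv_const _ _, hW.2.1⟩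
      · have hev : (fun t : ℝ => max (-1) (min 1 t)) =ᶠ[𝓝 t] fun _ => 1 := by
          filter_upwards [Ioi_mem_nhds ht] with x hx using hvtop x (le_of_lt hx)
        rw [hev.deriv_eq, hev.eq_of_nhds]
        exact ⟨deriv_const _ _, hW.2.2.1⟩

/-- Replacing the part of `u` before `s` by a steep transition from `-1` gains the cost of the
earlier crossing of `0` up to the cost of that transition. -/
lemma le_LaE_of_return {a W u : ℝ → ℝ} {a₁ a₂ K c δ s τ : ℝ} {m : ℝ≥0∞} (hW : DoubleWell W)
    (ha₁ : 0 < a₁) (ha : ∀ t, a₁ ≤ a t ∧ a t ≤ a₂)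
    (hK : ∀ x ∈ Icc (-1:ℝ) 1, W x ≤ K) (hc : 0 < c)
    (hcW : ∀ x ∈ Icc (-1 / 2 : ℝ) (1 / 2), c ≤ W x)
    (hm : ∀ v, memX1 v → m ≤ LaE a W v) (hu : memX1 u) (hu1 : ∀ t, |u t| ≤ 1)
    (hτ : u τ = 0) (hτs : τ ≤ s) (hs : u s ≤ -1 + δ) :
    m + ENNReal.ofReal (a₁ * c / 2)
      ≤ LaE a W u + ENNReal.ofReal (1 + a₂ * K) * ENNReal.ofReal δ := by
  set g : ℝ → ℝ := fun t => max (-1) (u s - (s - t)) with hg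
  have ha0 : ∀ t, 0 ≤ a t := fun t => ha₁.le.trans (ha t).1
  have hgL : LipschitzWith 1 g := by
    refine LipschitzWith.const_max (lipschitzWith_one_of_abs fun x y => ?_) _
    rw [show u s - (s - x) - (u s - (s - y)) = x - y by ring]
  have hgs : g s = u s := by
    simp only [hg, sub_self, sub_zero]
    exact max_eq_right (abs_le.1 (hu1 s)).1
  have hgbot : ∀ t, t ≤ s - δ → g t = -1 := fun t ht => max_eq_left (by linarith)
  set v : ℝ → ℝ := fun t => if t ≤ s then g t else u t with hv
  have hvlt : ∀ t, t ≤ s → v t = g t := fun t ht => if_pos ht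
  have hvX : memX1 v := by
    refine ⟨lipschitzWith_glue hgL hu.1 hgs, hu.2.1.congr' ?_, tendsto_const_nhds.congr' ?_⟩
    · filter_upwards [eventually_gt_atTop s] with t ht
      simp [hv, not_le.2 ht]
    · filter_upwards [eventually_le_atBot s, eventually_le_atBot (s - δ)] with t h1 h2
      rw [hvlt t h1, hgbot t h2]
  have hv1 : ∀ t, |v t| ≤ 1 := by
    intro t
    by_cases h : t ≤ s
    · rw [hvlt t h]
      exact abs_le.2 ⟨le_max_left _ _, max_le (by norm_num)
        (by linarith [(abs_le.1 (hu1 s)).2])⟩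
    · simpa only [hv, if_neg h] using hu1 t
  have hleft : ∫⁻ t in Iic s, ENNReal.ofReal (kin (deriv v t) + a t * W (v t))
      ≤ ENNReal.ofReal (1 + a₂ * K) * ENNReal.ofReal δ := by
    have h := LaE_setLIntegral_le (v := v) (a := a) (a₂ := a₂) hK hW.nonneg (fun t => (ha t).2)
      ha0 hv1 (Iic s) (p := s - δ) (q := s) ?_ measurableSet_Iic
    · simpa using h
    · intro t ht htn
      have htlt : t < s - δ := by
        by_contra h
        exact htn ⟨not_lt.1 h, ht⟩
      by_cases hts : t < s
      · have hev : v =ᶠ[𝓝 t] fun _ => -1 := by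
          filter_upwards [Iio_mem_nhds htlt, Iio_mem_nhds hts] with x hx1 hx2
          rw [hvlt x (le_of_lt hx2), hgbot x (le_of_lt hx1)]
        rw [hev.deriv_eq, hev.eq_of_nhds]
        exact ⟨deriv_const _ _, hW.2.1⟩
      · have := (abs_le.1 (hu1 s)).1
        linarith
  have hright : ∫⁻ t in Ioi s, ENNReal.ofReal (kin (deriv v t) + a t * W (v t))
      = ∫⁻ t in Ioi s, ENNReal.ofReal (kin (deriv u t) + a t * W (u t)) := by
    refine setLIntegral_congr_fun measurableSet_Ioi fun t ht => ?_
    have h1 : deriv v t = deriv u t := deriv_glue_of_gt ht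
    have h2 : v t = u t := if_neg (not_le.2 ht)
    simp only [h1, h2]
  have hlow : ENNReal.ofReal (a₁ * c / 2)
      ≤ ∫⁻ t in Iic s, ENNReal.ofReal (kin (deriv u t) + a t * W (u t)) := by
    calc ENNReal.ofReal (a₁ * c / 2)
        = ∫⁻ t in Icc (τ - 1 / 2) τ, ENNReal.ofReal (a₁ * c) := by
          rw [setLIntegral_const, Real.volume_Icc, ← ENNReal.ofReal_mul (by positivity)]
          congr 1; ring
      _ ≤ ∫⁻ t in Icc (τ - 1 / 2) τ, ENNReal.ofReal (kin (deriv u t) + a t * W (u t)) := by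
          refine setLIntegral_mono' measurableSet_Icc fun t ht => ENNReal.ofReal_le_ofReal ?_
          have h1 := hu.1.abs_sub_le_abs_sub t τ
          rw [hτ, sub_zero, abs_of_nonpos (by linarith [ht.2] : t - τ ≤ 0)] at h1
          have h2 := abs_le.1 (h1.trans (by linarith [ht.1] : -(t - τ) ≤ 1 / 2))
          have h3 := mul_le_mul (ha t).1 (hcW (u t) ⟨by linarith [h2.1], h2.2⟩) hc.le (ha0 t)
          linarith [kin_nonneg (deriv u t)]
      _ ≤ _ := lintegral_mono_set fun t ht => ht.2.trans hτs
  have split : ∀ w : ℝ → ℝ, LaE a W w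
      = (∫⁻ t in Iic s, ENNReal.ofReal (kin (deriv w t) + a t * W (w t)))
        + ∫⁻ t in Ioi s, ENNReal.ofReal (kin (deriv w t) + a t * W (w t)) := by
    intro w
    rw [LaE_eq, ← lintegral_add_compl _ (measurableSet_Iic (a := s)), compl_Iic]
  calc m + ENNReal.ofReal (a₁ * c / 2)
      ≤ (ENNReal.ofReal (1 + a₂ * K) * ENNReal.ofReal δ
          + ∫⁻ t in Ioi s, ENNReal.ofReal (kin (deriv u t) + a t * W (u t)))
        + ∫⁻ t in Iic s, ENNReal.ofReal (kin (deriv u t) + a t * W (u t)) := by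
        refine add_le_add ((hm v hvX).trans ?_) hlow
        rw [split v, hright]
        exact add_le_add hleft le_rfl
    _ = _ := by rw [split u]; ring

/-- A `1`-Lipschitz function with values in `[-1, 1]`, finite action, and staying away from `-1`
near `+∞` converges to `1` at `+∞`. -/
lemma tendsto_one_of_LaE_ne_top {α W u : ℝ → ℝ} {a₁ δ R : ℝ} (hW : DoubleWell W) (ha₁ : 0 < a₁)
    (hα : ∀ t, a₁ ≤ α t) (hu : LipschitzWith 1 u) (hu1 : ∀ t, |u t| ≤ 1)
    (hfin : LaE α W u ≠ ⊤) (hδ : 0 < δ) (hR : ∀ t, R ≤ t → -1 + δ ≤ u t) :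
    Tendsto u atTop (𝓝 1) := by
  have hcont : Continuous fun t => a₁ * W (u t) :=
    continuous_const.mul (hW.continuous.comp hu.continuous)
  have hnn : ∀ t, 0 ≤ a₁ * W (u t) := fun t => mul_nonneg ha₁.le (hW.nonneg _)
  have hInt : Integrable fun t => a₁ * W (u t) := by
    refine ⟨hcont.aestronglyMeasurable, ?_⟩
    rw [hasFiniteIntegral_iff_ofReal (Eventually.of_forall hnn)]
    refine lt_of_le_of_lt ?_ hfin.lt_top
    rw [LaE_eq]
    refine lintegral_mono fun t => ENNReal.ofReal_le_ofReal ?_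
    have := mul_le_mul_of_nonneg_right (hα t) (hW.nonneg (u t))
    linarith [kin_nonneg (deriv u t)]
  have hI := intervalIntegral_tendsto_integral_Ioi 0 hInt.integrableOn tendsto_id
  have hdiff : Tendsto (fun t => ∫ x in t..(t + 1), a₁ * W (u x)) atTop (𝓝 0) := by
    have h := (hI.comp (tendsto_atTop_add_const_right _ 1 tendsto_id)).sub hI
    rw [sub_self] at h
    refine h.congr fun t => ?_
    exact intervalIntegral.integral_interval_sub_left (hInt.intervalIntegrable)
      (hInt.intervalIntegrable)
  rw [Metric.tendsto_atTop']
  intro ε hε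
  obtain ⟨c, hc, hcW⟩ := hW.exists_pos_le (p := -1 + δ / 2) (q := 1 - ε / 2)
    (by linarith) (by linarith)
  set η : ℝ := min 1 (min (δ / 2) (ε / 2)) with hη
  have hη0 : 0 < η := lt_min one_pos (lt_min (by linarith) (by linarith))
  have hη1 : η ≤ 1 := min_le_left _ _
  have hηδ : η ≤ δ / 2 := (min_le_right _ _).trans (min_le_left _ _)
  have hηε : η ≤ ε / 2 := (min_le_right _ _).trans (min_le_right _ _)
  obtain ⟨N, hN⟩ := ((hdiff.eventually_lt_const (by positivity : 0 < a₁ * c * η)).and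
    (eventually_ge_atTop R)).exists_forall_of_atTop
  refine ⟨N, fun t ht => ?_⟩
  obtain ⟨h1, h2⟩ := hN t ht.le
  by_contra hcon
  rw [not_lt, Real.dist_eq, abs_of_nonpos (by linarith [(abs_le.1 (hu1 t)).2])] at hcon
  have hlow : a₁ * c * η ≤ ∫ x in t..(t + η), a₁ * W (u x) := by
    have : ∫ x in t..(t + η), a₁ * c = a₁ * c * η := by simp; ring
    rw [← this]
    refine intervalIntegral.integral_mono_on (by linarith) (by simp) hInt.intervalIntegrable
      fun x hx => ?_
    refine mul_le_mul_of_nonneg_left (hcW _ ?_) ha₁.le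
    have h3 := hu.abs_sub_le_abs_sub x t
    rw [abs_of_nonneg (by linarith [hx.1] : 0 ≤ x - t)] at h3
    have h4 := abs_le.1 (h3.trans (by linarith [hx.2] : x - t ≤ η))
    exact ⟨by linarith [hR t h2, h4.1], by linarith [h4.2]⟩
  have hmono : ∫ x in t..(t + η), a₁ * W (u x) ≤ ∫ x in t..(t + 1), a₁ * W (u x) :=
    intervalIntegral.integral_mono_interval le_rfl (by linarith) (by linarith)
      (Eventually.of_forall hnn) hInt.intervalIntegrable
  linarith

lemma tendsto_neg_one_of_LaE_ne_top {α W u : ℝ → ℝ} {a₁ δ R : ℝ} (hW : DoubleWell W)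
    (ha₁ : 0 < a₁) (hα : ∀ t, a₁ ≤ α t) (hu : LipschitzWith 1 u) (hu1 : ∀ t, |u t| ≤ 1)
    (hfin : LaE α W u ≠ ⊤) (hδ : 0 < δ) (hR : ∀ t, t ≤ R → u t ≤ 1 - δ) :
    Tendsto u atBot (𝓝 (-1)) := by
  have hL : LipschitzWith 1 fun t => -u (-t) := lipschitzWith_one_of_abs fun s t => by
    have := hu.abs_sub_le_abs_sub (-t) (-s)
    rwa [show -t - -s = s - t by ring, show u (-t) - u (-s) = -u (-s) - -u (-t) by ring] at this
  have h := tendsto_one_of_LaE_ne_top (α := fun t => α (-t)) (W := fun s => W (-s)) (R := -R)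
    hW.reflect ha₁ (fun t => hα _) hL (fun t => by simpa using hu1 (-t))
    (by rwa [LaE_reflect]) hδ (fun t ht => by linarith [hR (-t) (by linarith)])
  have := (h.comp tendsto_neg_atBot_atTop).neg
  simpa [Function.comp_def] using this

/-- Sequential compactness of `1`-Lipschitz functions `ℝ → [-1, 1]` for pointwise convergence. -/
lemma exists_subseq_tendsto_of_lipschitz {v : ℕ → ℝ → ℝ} (hv : ∀ n, LipschitzWith 1 (v n))
    (hv1 : ∀ n t, |v n t| ≤ 1) :
    ∃ (φ : ℕ → ℕ) (u : ℝ → ℝ), StrictMono φ ∧ LipschitzWith 1 u ∧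
      ∀ t, Tendsto (fun n => v (φ n) t) atTop (𝓝 (u t)) := by
  have hK : IsCompact (Set.pi univ fun _ : ℚ => Icc (-1:ℝ) 1) :=
    isCompact_univ_pi fun _ => isCompact_Icc
  obtain ⟨g, -, φ, hφ, hg⟩ := hK.tendsto_subseq (x := fun n (q : ℚ) => v n q)
    fun n q _ => abs_le.1 (hv1 n q)
  rw [tendsto_pi_nhds] at hg
  have hcau : ∀ t, CauchySeq fun n => v (φ n) t := by
    intro t
    rw [Metric.cauchySeq_iff]
    intro ε hε
    obtain ⟨q, hq1, hq2⟩ := exists_rat_btwn (show t < t + ε / 3 by linarith)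
    obtain ⟨N, hN⟩ := Metric.cauchySeq_iff.1 (hg q).cauchySeq (ε / 3) (by linarith)
    refine ⟨N, fun m hm n hn => ?_⟩
    have h1 := hN m hm n hn
    have h2 := (hv (φ m)).abs_sub_le_abs_sub t q
    have h3 := (hv (φ n)).abs_sub_le_abs_sub t q
    rw [Real.dist_eq] at h1 ⊢
    simp only [Function.comp_apply] at h1
    rw [abs_of_nonpos (by linarith : t - (q:ℝ) ≤ 0)] at h2 h3
    rw [abs_lt] at h1 ⊢
    rw [abs_le] at h2 h3
    constructor <;> linarith [h1.1, h1.2, h2.1, h2.2, h3.1, h3.2]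
  choose u hu using fun t => cauchySeq_tendsto_of_complete (hcau t)
  refine ⟨φ, u, hφ, lipschitzWith_one_of_abs fun s t => ?_, hu⟩
  exact le_of_tendsto' ((hu s).sub (hu t)).abs fun n => (hv (φ n)).abs_sub_le_abs_sub s t

/-- Limits of almost minimizing sequences whose transition layers stay in a bounded region. -/
lemma exists_limit_memX1 {W : ℝ → ℝ} (hW : DoubleWell W) {a₁ δ R : ℝ} (ha₁ : 0 < a₁) (hδ : 0 < δ)
    {α : ℕ → ℝ → ℝ} {α' : ℝ → ℝ} {v : ℕ → ℝ → ℝ} (hmα : ∀ n, Measurable (α n))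
    (hα : ∀ n t, a₁ ≤ α n t) (hαlim : ∀ t, Tendsto (fun n => α n t) atTop (𝓝 (α' t)))
    (hv : ∀ n, LipschitzWith 1 (v n)) (hv1 : ∀ n t, |v n t| ≤ 1)
    {c : ℕ → ℝ≥0∞} {m : ℝ≥0∞} (hc : ∀ n, LaE (α n) W (v n) ≤ c n)
    (hcm : Tendsto c atTop (𝓝 m)) (hm : m ≠ ⊤)
    (hright : ∀ n t, R ≤ t → -1 + δ ≤ v n t) (hleft : ∀ n t, t ≤ -R → v n t ≤ 1 - δ) :
    ∃ u, memX1 u ∧ (∀ t, |u t| ≤ 1) ∧ LaE α' W u ≤ m := by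
  obtain ⟨φ, u, hφ, hu, hlim⟩ := exists_subseq_tendsto_of_lipschitz hv hv1
  have hle : LaE α' W u ≤ m :=
    LaE_le_of_tendsto hW.continuous hW.nonneg (fun n => hmα (φ n))
      (fun n t => ha₁.le.trans (hα _ t)) (fun t => (hαlim t).comp hφ.tendsto_atTop)
      (fun n => hv (φ n)) hu hlim (fun n => hc (φ n)) (hcm.comp hφ.tendsto_atTop)
  have hu1 : ∀ t, |u t| ≤ 1 := fun t => le_of_tendsto' (hlim t).abs fun n => hv1 _ t
  have hα' : ∀ t, a₁ ≤ α' t := fun t => ge_of_tendsto' (hαlim t) fun n => hα n t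
  have hfin : LaE α' W u ≠ ⊤ := ne_top_of_le_ne_top hm hle
  refine ⟨u, ⟨hu, ?_, ?_⟩, hu1, hle⟩
  · exact tendsto_one_of_LaE_ne_top hW ha₁ hα' hu hu1 hfin hδ
      fun t ht => ge_of_tendsto' (hlim t) fun n => hright _ t ht
  · exact tendsto_neg_one_of_LaE_ne_top hW ha₁ hα' hu hu1 hfin hδ
      fun t ht => le_of_tendsto' (hlim t) fun n => hleft _ t ht

lemma memX1.exists_eq_zero {u : ℝ → ℝ} (hu : memX1 u) : ∃ τ, u τ = 0 := by
  obtain ⟨s, hs⟩ := (hu.2.2.eventually_lt_const (by norm_num : (-1:ℝ) < 0)).exists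
  obtain ⟨t, ht⟩ := (hu.2.1.eventually_const_lt (by norm_num : (0:ℝ) < 1)).exists
  exact mem_range_of_exists_le_of_exists_ge hu.1.continuous ⟨s, hs.le⟩ ⟨t, ht.le⟩

/-- Existence of a minimizer with values in `[-1, 1]`. -/
lemma exists_minimizer {W a : ℝ → ℝ} {a₁ a₂ : ℝ}
    (hW : DoubleWell W) (hma : Measurable a)
    (ha₁ : 0 < a₁) (ha : ∀ t : ℝ, a₁ ≤ a t ∧ a t ≤ a₂)
    (hlimT : Tendsto a atTop (𝓝 a₂)) (hlimB : Tendsto a atBot (𝓝 a₂)) :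
    ∃ u, memX1 u ∧ (∀ t, |u t| ≤ 1) ∧ LaE a W u ≠ ⊤ ∧
      ∀ v, memX1 v → LaE a W u ≤ LaE a W v := by
  have ha0 : ∀ t, 0 ≤ a t := fun t => ha₁.le.trans (ha t).1
  have ha₂ : 0 < a₂ := ha₁.trans_le ((ha 0).1.trans (ha 0).2)
  obtain ⟨K, hK⟩ := isCompact_Icc.bddAbove_image (K := Icc (-1:ℝ) 1) hW.continuous.continuousOn
  replace hK : ∀ x ∈ Icc (-1:ℝ) 1, W x ≤ K := fun x hx => hK (mem_image_of_mem _ hx)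
  have hK0 : 0 ≤ K := (hW.nonneg 0).trans (hK 0 (by norm_num))
  obtain ⟨c, hc, hcW⟩ := hW.exists_pos_le (p := -1 / 2) (q := 1 / 2) (by norm_num) (by norm_num)
  obtain ⟨m, hm, hm_top, hmin⟩ : ∃ m : ℝ≥0∞, (∀ v, memX1 v → m ≤ LaE a W v) ∧ m ≠ ⊤ ∧
      ∀ b, m < b → ∃ v, memX1 v ∧ LaE a W v < b := by
    refine ⟨sInf (LaE a W '' {v | memX1 v}), fun v hv => sInf_le (mem_image_of_mem _ hv), ?_, ?_⟩
    · obtain ⟨v, hv, hvt⟩ := exists_memX1_LaE_ne_top hW ha0 fun t => (ha t).2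
      exact ne_top_of_le_ne_top hvt (sInf_le (mem_image_of_mem _ hv))
    · intro b hb
      obtain ⟨_, ⟨v, hv, rfl⟩, hvb⟩ := sInf_lt_iff.1 hb
      exact ⟨v, hv, hvb⟩
  set κ : ℝ := a₁ * c / 2 with hκ
  have hκ0 : 0 < κ := by positivity
  set C : ℝ := 1 + a₂ * K with hC
  have hC0 : 0 < C := by positivity
  set δ : ℝ := κ / 2 / C with hδdef
  have hδ : 0 < δ := by positivity
  set η : ℕ → ℝ := fun n => κ / 4 * (1 / (n + 1)) with hη
  have hη0 : ∀ n, 0 < η n := fun n => by positivity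
  have hηle : ∀ n, η n ≤ κ / 4 := fun n => by
    have : (1:ℝ) / (n + 1) ≤ 1 := by
      rw [div_le_one (by positivity)]
      linarith [(Nat.cast_nonneg n : (0:ℝ) ≤ n)]
    exact mul_le_of_le_one_right (by positivity) this
  have hηlim : Tendsto (fun n => m + ENNReal.ofReal (η n)) atTop (𝓝 m) := by
    have h1 : Tendsto η atTop (𝓝 0) := by
      simpa [hη] using (tendsto_one_div_add_atTop_nhds_zero_nat (𝕜 := ℝ)).const_mul (κ / 4)
    simpa using tendsto_const_nhds.add (ENNReal.tendsto_ofReal h1)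
  have hex : ∀ n, ∃ u, memX1 u ∧ (∀ t, |u t| ≤ 1) ∧ LaE a W u ≤ m + ENNReal.ofReal (η n) := by
    intro n
    obtain ⟨v, hv, hvb⟩ := hmin (m + ENNReal.ofReal (η n))
      (ENNReal.lt_add_right hm_top (by simpa using hη0 n))
    obtain ⟨u, hu, hu1, hle⟩ := hv.exists_truncate hW ha0
    exact ⟨u, hu, hu1, hle.trans hvb.le⟩
  choose u hu hu1 hle using hex
  choose τ hτ using fun n => (hu n).exists_eq_zero
  have hcontra : ∀ n, ¬ (m + ENNReal.ofReal κ
      ≤ LaE a W (u n) + ENNReal.ofReal C * ENNReal.ofReal δ) := by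
    intro n h
    have h1 := h.trans (add_le_add (hle n) le_rfl)
    rw [add_assoc, ENNReal.add_le_add_iff_left hm_top, ← ENNReal.ofReal_mul hC0.le,
      ← ENNReal.ofReal_add (hη0 n).le (by positivity),
      ENNReal.ofReal_le_ofReal_iff (add_nonneg (hη0 n).le (by positivity))] at h1
    have h2 : C * δ = κ / 2 := by rw [hδdef]; field_simp
    linarith [hηle n]
  have hright : ∀ n t, τ n ≤ t → -1 + δ ≤ u n t := by
    intro n t ht
    by_contra hcon
    exact hcontra n (le_LaE_of_return hW ha₁ ha hK hc hcW hm (hu n) (hu1 n) (hτ n) ht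
      (not_le.1 hcon).le)
  have hleft : ∀ n t, t ≤ τ n → u n t ≤ 1 - δ := by
    intro n t ht
    by_contra hcon
    refine hcontra n ?_
    rw [← LaE_reflect a W (u n)]
    refine le_LaE_of_return (s := -t) (τ := -τ n) hW.reflect ha₁ (fun t => ha (-t))
      (fun x hx => hK (-x) ⟨by linarith [hx.2], by linarith [hx.1]⟩) hc
      (fun x hx => hcW (-x) ⟨by linarith [hx.2], by linarith [hx.1]⟩) (fun v hv => ?_)
      (hu n).reflect (fun t => by simpa using hu1 n (-t)) (by simp [hτ n]) (by linarith) ?_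
    · have := LaE_reflect a W (fun t => -v (-t))
      simp only [neg_neg] at this
      rw [this]
      exact hm _ hv.reflect
    · simp only [neg_neg]
      linarith
  suffices h : ∃ u, memX1 u ∧ (∀ t, |u t| ≤ 1) ∧ LaE a W u ≤ m by
    obtain ⟨u, hu, hu1, hum⟩ := h
    exact ⟨u, hu, hu1, ne_top_of_le_ne_top hm_top hum, fun v hv => hum.trans (hm v hv)⟩
  by_cases hesc : Tendsto (fun n => |τ n|) atTop atTop
  · have halim : ∀ t, Tendsto (fun n => a (t + τ n)) atTop (𝓝 a₂) := by
      intro t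
      have h1 : Tendsto a (cocompact ℝ) (𝓝 a₂) := by
        rw [cocompact_eq_atBot_atTop]
        exact hlimB.sup hlimT
      refine h1.comp ?_
      rw [← Metric.cobounded_eq_cocompact, ← tendsto_norm_atTop_iff_cobounded]
      refine tendsto_atTop_mono (fun n => ?_) (tendsto_atTop_add_const_right _ (-|t|) hesc)
      rw [Real.norm_eq_abs]
      have h2 := abs_sub (t + τ n) t
      rw [add_sub_cancel_left] at h2
      linarith
    obtain ⟨w, hw, hw1, hwm⟩ := exists_limit_memX1 (R := 0) hW ha₁ hδ
      (α := fun n t => a (t + τ n)) (α' := fun _ => a₂) (v := fun n t => u n (t + τ n))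
      (fun n => hma.comp (by fun_prop)) (fun n t => (ha _).1) halim
      (fun n => ((hu n).translate (τ n)).1) (fun n t => hu1 n _)
      (fun n => (LaE_translate a W (u n) (τ n)).trans_le (hle n)) hηlim hm_top
      (fun n t ht => hright n _ (by linarith)) (fun n t ht => hleft n _ (by linarith))
    exact ⟨w, hw, hw1, (LaE_mono_weight hW.nonneg fun t => (ha t).2).trans hwm⟩
  · rw [tendsto_atTop] at hesc
    push Not at hesc
    obtain ⟨R, hR⟩ := hesc
    obtain ⟨φ, hφ, hφR⟩ := extraction_of_frequently_atTop hR
    exact exists_limit_memX1 (R := R) hW ha₁ hδ (α := fun _ => a) (v := fun n => u (φ n))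
      (fun _ => hma) (fun _ t => (ha t).1) (fun t => tendsto_const_nhds)
      (fun n => (hu (φ n)).1) (fun n => hu1 (φ n)) (fun n => hle (φ n))
      (hηlim.comp hφ.tendsto_atTop) hm_top
      (fun n t ht => hright _ t (by linarith [(abs_lt.1 (hφR n)).2]))
      (fun n t ht => hleft _ t (by linarith [(abs_lt.1 (hφR n)).1]))

/-- The inverse `y ↦ y / √(1 + y²)` of `p ↦ p / √(1 - p²)`. -/
def psi (y : ℝ) : ℝ := y / Real.sqrt (1 + y ^ 2)

lemma sqrt_one_add_sq_pos (y : ℝ) : 0 < Real.sqrt (1 + y ^ 2) := Real.sqrt_pos.2 (by positivity)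

lemma continuous_psi : Continuous psi :=
  continuous_id.div (by fun_prop) fun y => (sqrt_one_add_sq_pos y).ne'

lemma psi_neg (y : ℝ) : psi (-y) = -psi y := by simp [psi, neg_div]

lemma sqrt_one_sub_psi_sq (y : ℝ) :
    Real.sqrt (1 - psi y ^ 2) = (Real.sqrt (1 + y ^ 2))⁻¹ := by
  have h := Real.sq_sqrt (by positivity : 0 ≤ 1 + y ^ 2)
  rw [← Real.sqrt_inv]
  congr 1
  rw [psi, div_pow, h]
  field_simp
  ring

lemma psi_div_sqrt (y : ℝ) : psi y / Real.sqrt (1 - psi y ^ 2) = y := by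
  have h := (sqrt_one_add_sq_pos y).ne'
  rw [sqrt_one_sub_psi_sq, psi]
  field_simp

lemma abs_psi_lt_one (y : ℝ) : |psi y| < 1 := by
  rw [psi, abs_div, abs_of_pos (sqrt_one_add_sq_pos y), div_lt_one (sqrt_one_add_sq_pos y)]
  exact Real.lt_sqrt_of_sq_lt (by rw [sq_abs]; linarith)

lemma abs_psi_le (y : ℝ) : |psi y| ≤ |y| := by
  rw [psi, abs_div, abs_of_pos (sqrt_one_add_sq_pos y)]
  exact div_le_self (abs_nonneg _) (Real.one_le_sqrt.2 (by nlinarith [sq_nonneg y]))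

lemma half_le_psi {y : ℝ} (hy : 1 ≤ y) : 1 / 2 ≤ psi y := by
  rw [psi, le_div_iff₀ (sqrt_one_add_sq_pos y)]
  have : Real.sqrt (1 + y ^ 2) ≤ 2 * y := Real.sqrt_le_iff.2 ⟨by linarith, by nlinarith⟩
  linarith

lemma kin_psi (y : ℝ) : kin (psi y) = 1 - (Real.sqrt (1 + y ^ 2))⁻¹ := by
  rw [kin, sqrt_one_sub_psi_sq]

/-- The excess in the Young inequality for `kin`. -/
lemma kin_sub_kin_psi (p y : ℝ) :
    kin p - kin (psi y) - y * (p - psi y)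
      = Real.sqrt (1 + y ^ 2) - Real.sqrt (1 - p ^ 2) - y * p := by
  have h := (sqrt_one_add_sq_pos y).ne'
  have h2 := Real.sq_sqrt (by positivity : 0 ≤ 1 + y ^ 2)
  rw [kin_psi, kin, psi]
  field_simp
  linear_combination -h2

lemma kin_excess_nonneg {p : ℝ} (hp : |p| ≤ 1) (y : ℝ) :
    0 ≤ kin p - kin (psi y) - y * (p - psi y) := by
  rw [kin_sub_kin_psi]
  have h1 := Real.sq_sqrt (by positivity : 0 ≤ 1 + y ^ 2)
  have h2 := Real.sq_sqrt (by nlinarith [abs_le.1 hp] : 0 ≤ 1 - p ^ 2)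
  have h3 : Real.sqrt (1 - p ^ 2) + y * p ≤ Real.sqrt (1 + y ^ 2) := by
    apply Real.le_sqrt_of_sq_le
    nlinarith [sq_nonneg (y * Real.sqrt (1 - p ^ 2) - p)]
  linarith

lemma eq_psi_of_kin_excess_eq_zero {p : ℝ} (hp : |p| ≤ 1) {y : ℝ}
    (h : kin p - kin (psi y) - y * (p - psi y) = 0) : p = psi y := by
  rw [kin_sub_kin_psi] at h
  have h1 := Real.sq_sqrt (by positivity : 0 ≤ 1 + y ^ 2)
  have h2 := Real.sq_sqrt (by nlinarith [abs_le.1 hp] : 0 ≤ 1 - p ^ 2)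
  have h3 : Real.sqrt (1 + y ^ 2) = Real.sqrt (1 - p ^ 2) + y * p := by linarith
  have h4 : y * Real.sqrt (1 - p ^ 2) - p = 0 := by
    have : (y * Real.sqrt (1 - p ^ 2) - p) ^ 2 = 0 := by
      rw [h3] at h1
      nlinarith
    exact pow_eq_zero_iff two_ne_zero |>.1 this
  rw [psi, eq_div_iff (sqrt_one_add_sq_pos y).ne', h3]
  linear_combination -Real.sqrt (1 - p ^ 2) * h4 + y * h2

lemma intervalIntegrable_of_bdd {f : ℝ → ℝ} (hf : Measurable f) {C : ℝ} (hC : ∀ x, |f x| ≤ C)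
    (s t : ℝ) : IntervalIntegrable f volume s t :=
  ⟨integrableOn_of_bdd hf hC _ (by simp), integrableOn_of_bdd hf hC _ (by simp)⟩

lemma intervalIntegrable_kin_deriv (u : ℝ → ℝ) (s t : ℝ) :
    IntervalIntegrable (fun r => kin (deriv u r)) volume s t :=
  intervalIntegrable_of_bdd (continuous_kin.measurable.comp (measurable_deriv u)) (C := 1)
    (fun _ => abs_le.2 ⟨neg_one_lt_zero.le.trans (kin_nonneg _), kin_le_one _⟩) s t

/-- A minimizer minimizes the action on every compact interval with fixed outer values. -/
lemma integral_le_of_minimizer {a W u v : ℝ → ℝ} {a₂ T : ℝ} (hT : 0 ≤ T) (hW : Continuous W)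
    (hW0 : ∀ s, 0 ≤ W s) (hma : Measurable a) (ha : ∀ t, 0 ≤ a t ∧ a t ≤ a₂) (hu : memX1 u)
    (hfin : LaE a W u ≠ ⊤) (hmin : ∀ v, memX1 v → LaE a W u ≤ LaE a W v)
    (hv : LipschitzWith 1 v) (hvu : ∀ t, t ∉ Icc (-T) T → v t = u t) :
    ∫ t in (-T)..T, (kin (deriv u t) + a t * W (u t))
      ≤ ∫ t in (-T)..T, (kin (deriv v t) + a t * W (v t)) := by
  have hvX : memX1 v := by
    refine ⟨hv, hu.2.1.congr' ?_, hu.2.2.congr' ?_⟩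
    · filter_upwards [eventually_gt_atTop T] with t ht
      exact (hvu t fun h => ht.not_ge h.2).symm
    · filter_upwards [eventually_lt_atBot (-T)] with t ht
      exact (hvu t fun h => ht.not_ge h.1).symm
  have hInt : ∀ w : ℝ → ℝ, LipschitzWith 1 w →
      IntegrableOn (fun t => kin (deriv w t) + a t * W (w t)) (Icc (-T) T) := by
    intro w hw
    have hai : IntervalIntegrable a volume (-T) T :=
      intervalIntegrable_of_bdd hma (C := a₂)
        (fun x => abs_le.2 ⟨by linarith [(ha x).1, (ha x).2], (ha x).2⟩) _ _
    have h := (intervalIntegrable_kin_deriv w (-T) T).add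
      (hai.mul_continuousOn (hW.comp hw.continuous).continuousOn)
    rwa [intervalIntegrable_iff_integrableOn_Icc_of_le (by linarith)] at h
  have hnn : ∀ w : ℝ → ℝ, ∀ t, 0 ≤ kin (deriv w t) + a t * W (w t) := fun w t =>
    add_nonneg (kin_nonneg _) (mul_nonneg (ha t).1 (hW0 _))
  have split : ∀ w : ℝ → ℝ, LaE a W w
      = (∫⁻ t in Icc (-T) T, ENNReal.ofReal (kin (deriv w t) + a t * W (w t)))
        + ∫⁻ t in (Icc (-T) T)ᶜ, ENNReal.ofReal (kin (deriv w t) + a t * W (w t)) := by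
    intro w
    rw [LaE_eq, lintegral_add_compl _ measurableSet_Icc]
  have hout : ∫⁻ t in (Icc (-T) T)ᶜ, ENNReal.ofReal (kin (deriv v t) + a t * W (v t))
      = ∫⁻ t in (Icc (-T) T)ᶜ, ENNReal.ofReal (kin (deriv u t) + a t * W (u t)) := by
    refine setLIntegral_congr_fun measurableSet_Icc.compl fun t ht => ?_
    have hev : v =ᶠ[𝓝 t] u := by
      filter_upwards [isClosed_Icc.isOpen_compl.mem_nhds ht] with x hx using hvu x hx
    simp only [hev.deriv_eq, hev.eq_of_nhds]
  have hle := hmin v hvX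
  rw [split u] at hfin
  rw [split u, split v, hout,
    ENNReal.add_le_add_iff_right (ENNReal.add_ne_top.1 hfin).2] at hle
  rw [intervalIntegral.integral_of_le (by linarith), intervalIntegral.integral_of_le (by linarith),
    ← integral_Icc_eq_integral_Ioc, ← integral_Icc_eq_integral_Ioc]
  rw [← ofReal_integral_eq_lintegral_ofReal (hInt u hu.1) (Eventually.of_forall (hnn u)),
    ← ofReal_integral_eq_lintegral_ofReal (hInt v hv) (Eventually.of_forall (hnn v)),
    ENNReal.ofReal_le_ofReal_iff (integral_nonneg (hnn v))] at hle
  exact hle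

lemma hasDerivAt_integral_potential {a W u d : ℝ → ℝ} {a₂ T : ℝ} (hW : ContDiff ℝ 1 W)
    (hma : Measurable a) (ha : ∀ t, 0 ≤ a t ∧ a t ≤ a₂)
    (hu : Continuous u) (hd : Continuous d) :
    HasDerivAt (fun ε => ∫ t in (-T)..T, a t * W (u t + ε * d t))
      (∫ t in (-T)..T, a t * deriv W (u t) * d t) 0 := by
  have hWd : Continuous (deriv W) := hW.continuous_deriv le_rfl
  have hai : IntervalIntegrable a volume (-T) T :=
    intervalIntegrable_of_bdd hma (C := a₂)
      (fun x => abs_le.2 ⟨by linarith [(ha x).1, (ha x).2], (ha x).2⟩) _ _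
  obtain ⟨B, hB⟩ := (isCompact_Icc.prod isCompact_uIcc).exists_bound_of_continuousOn
    (s := Icc (-1:ℝ) 1 ×ˢ uIcc (-T) T)
    (f := fun p : ℝ × ℝ => deriv W (u p.2 + p.1 * d p.2) * d p.2) (by fun_prop)
  have hmeas : ∀ ε : ℝ, Measurable fun t => a t * W (u t + ε * d t) := fun ε =>
    hma.mul (hW.continuous.comp (by fun_prop : Continuous fun t => u t + ε * d t)).measurable
  have h := intervalIntegral.hasDerivAt_integral_of_dominated_loc_of_deriv_le
    (μ := volume) (a := -T) (b := T) (x₀ := (0:ℝ)) (s := Metric.ball 0 1)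
    (F := fun ε t => a t * W (u t + ε * d t))
    (F' := fun ε t => a t * (deriv W (u t + ε * d t) * d t)) (bound := fun _ => a₂ * B)
    (Metric.ball_mem_nhds _ one_pos)
    (Eventually.of_forall fun ε => (hmeas ε).aestronglyMeasurable)
    (hai.mul_continuousOn (hW.continuous.comp
      (by fun_prop : Continuous fun t => u t + 0 * d t)).continuousOn)
    (hma.mul (by fun_prop : Continuous fun t =>
      deriv W (u t + 0 * d t) * d t).measurable).aestronglyMeasurable
    (Eventually.of_forall fun t ht ε hε => ?_) (by simp)
    (Eventually.of_forall fun t ht ε hε => ?_)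
  · simpa [mul_assoc] using h.2
  · rw [norm_mul, Real.norm_of_nonneg (ha t).1]
    have hε' : ε ∈ Icc (-1:ℝ) 1 := by
      rw [mem_ball_zero_iff, Real.norm_eq_abs, abs_lt] at hε
      exact ⟨hε.1.le, hε.2.le⟩
    exact mul_le_mul (ha t).2 (hB (ε, t) ⟨hε', uIoc_subset_uIcc ht⟩) (norm_nonneg _)
      ((ha t).1.trans (ha t).2)
  · have h1 : HasDerivAt (fun ε => u t + ε * d t) (d t) ε := by
      simpa using ((hasDerivAt_id ε).mul_const (d t)).const_add (u t)
    exact (((hW.differentiable one_ne_zero _).hasDerivAt.comp ε h1)).const_mul (a t)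

lemma nonneg_of_hasDerivAt_of_le {g : ℝ → ℝ} {g' : ℝ} (hg : HasDerivAt g g' 0)
    (h : ∀ ε, 0 < ε → ε ≤ 1 → g 0 ≤ g ε) : 0 ≤ g' := by
  refine ge_of_tendsto hg.tendsto_slope_zero_right ?_
  filter_upwards [Ioc_mem_nhdsGT (zero_lt_one (α := ℝ))] with ε hε
  rw [zero_add, smul_eq_mul]
  exact mul_nonneg (inv_nonneg.2 hε.1.le) (sub_nonneg.2 (h ε hε.1 hε.2))

/-- The variational inequality satisfied by a minimizer. -/
lemma variational_inequality {a W u w : ℝ → ℝ} {a₂ T : ℝ} (hT : 0 ≤ T) (hW : DoubleWell W)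
    (hma : Measurable a) (ha : ∀ t, 0 ≤ a t ∧ a t ≤ a₂) (hu : memX1 u)
    (hfin : LaE a W u ≠ ⊤) (hmin : ∀ v, memX1 v → LaE a W u ≤ LaE a W v)
    (hw : LipschitzWith 1 w) (hwu : ∀ t, t ∉ Icc (-T) T → w t = u t) :
    0 ≤ (∫ t in (-T)..T, (kin (deriv w t) - kin (deriv u t)))
      + ∫ t in (-T)..T, a t * deriv W (u t) * (w t - u t) := by
  have huc := hu.1.continuous
  have hwc := hw.continuous
  have hai : IntervalIntegrable a volume (-T) T :=
    intervalIntegrable_of_bdd hma (C := a₂)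
      (fun x => abs_le.2 ⟨by linarith [(ha x).1, (ha x).2], (ha x).2⟩) _ _
  have hΦ := hasDerivAt_integral_potential (T := T) hW.1 hma ha huc (hwc.fun_sub huc)
  set A := ∫ t in (-T)..T, (kin (deriv w t) - kin (deriv u t)) with hA
  refine nonneg_of_hasDerivAt_of_le
    (g := fun ε => ε * A + ∫ t in (-T)..T, a t * W (u t + ε * (w t - u t))) ?_ ?_
  · simpa using ((hasDerivAt_id (0:ℝ)).mul_const A).fun_add hΦ
  intro ε hε0 hε1
  have hvL : LipschitzWith 1 fun t => u t + ε * (w t - u t) := by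
    refine lipschitzWith_one_of_abs fun s t => ?_
    have h1 := hu.1.abs_sub_le_abs_sub s t
    have h2 := hw.abs_sub_le_abs_sub s t
    calc |u s + ε * (w s - u s) - (u t + ε * (w t - u t))|
        = |(1 - ε) * (u s - u t) + ε * (w s - w t)| := by congr 1; ring
      _ ≤ (1 - ε) * |u s - u t| + ε * |w s - w t| := by
          refine (abs_add_le _ _).trans ?_
          rw [abs_mul, abs_mul, abs_of_nonneg hε0.le, abs_of_nonneg (by linarith : 0 ≤ 1 - ε)]
      _ ≤ (1 - ε) * |s - t| + ε * |s - t| := by gcongr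
      _ = |s - t| := by ring
  have hpot : ∀ ε : ℝ, IntervalIntegrable (fun t => a t * W (u t + ε * (w t - u t)))
      volume (-T) T := fun ε => hai.mul_continuousOn
    (hW.continuous.comp (by fun_prop : Continuous fun t => u t + ε * (w t - u t))).continuousOn
  have hle := integral_le_of_minimizer hT hW.continuous hW.nonneg hma ha hu hfin hmin hvL
    fun t ht => by simp [hwu t ht]
  have hkin : ∫ t in (-T)..T, kin (deriv (fun t => u t + ε * (w t - u t)) t)
      ≤ ∫ t in (-T)..T, (kin (deriv u t) + ε * (kin (deriv w t) - kin (deriv u t))) := by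
    refine intervalIntegral.integral_mono_ae (by linarith) (intervalIntegrable_kin_deriv _ _ _)
      ((intervalIntegrable_kin_deriv _ _ _).add (((intervalIntegrable_kin_deriv _ _ _).sub
        (intervalIntegrable_kin_deriv _ _ _)).const_mul ε)) ?_
    filter_upwards [hu.1.ae_differentiableAt_real, hw.ae_differentiableAt_real] with t h1 h2
    have hd : deriv (fun t => u t + ε * (w t - u t)) t
        = (1 - ε) * deriv u t + ε * deriv w t := by
      rw [(h1.hasDerivAt.fun_add ((h2.hasDerivAt.fun_sub h1.hasDerivAt).const_mul ε)).deriv]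
      ring
    rw [hd]
    have := convexOn_kin.2 (abs_le.1 (hu.1.abs_deriv_le_one t)) (abs_le.1 (hw.abs_deriv_le_one t))
      (by linarith : 0 ≤ 1 - ε) hε0.le (by ring)
    simp only [smul_eq_mul] at this
    linarith
  have h0 := hpot 0
  simp only [zero_mul, add_zero] at h0
  rw [intervalIntegral.integral_add (intervalIntegrable_kin_deriv _ _ _) h0,
    intervalIntegral.integral_add (intervalIntegrable_kin_deriv _ _ _) (hpot ε)] at hle
  rw [intervalIntegral.integral_add (intervalIntegrable_kin_deriv _ _ _)
    (((intervalIntegrable_kin_deriv _ _ _).sub (intervalIntegrable_kin_deriv _ _ _)).const_mul ε),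
    intervalIntegral.integral_const_mul, ← hA] at hkin
  simp only [zero_mul, add_zero, zero_add]
  linarith

lemma exists_integral_psi_eq {H : ℝ → ℝ} (hH : Continuous H) {T D : ℝ} (hT : 0 < T)
    (hD : |D| ≤ T) : ∃ c, ∫ r in (-T)..T, psi (c + H r) = D := by
  obtain ⟨B, hB⟩ := (isCompact_Icc (a := -T) (b := T)).exists_bound_of_continuousOn
    hH.continuousOn
  have hcont : Continuous fun c => ∫ r in (-T)..T, psi (c + H r) :=
    intervalIntegral.continuous_parametric_intervalIntegral_of_continuous'
      (f := fun c r => psi (c + H r))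
      (continuous_psi.comp (by fun_prop : Continuous fun p : ℝ × ℝ => p.1 + H p.2)) _ _
  have hInt : ∀ c, IntervalIntegrable (fun r => psi (c + H r)) volume (-T) T := fun c =>
    (continuous_psi.comp (by fun_prop : Continuous fun r => c + H r)).intervalIntegrable _ _
  have hup : D ≤ ∫ r in (-T)..T, psi ((1 + B) + H r) := by
    calc D ≤ T := (abs_le.1 hD).2
      _ = ∫ r in (-T)..T, (1 / 2 : ℝ) := by simp; ring
      _ ≤ _ := intervalIntegral.integral_mono_on (by linarith) (by simp) (hInt _) fun r hr =>
          half_le_psi (by linarith [(abs_le.1 (hB r hr)).1])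
  have hdn : ∫ r in (-T)..T, psi (-(1 + B) + H r) ≤ D := by
    calc _ ≤ ∫ r in (-T)..T, (-(1 / 2) : ℝ) :=
          intervalIntegral.integral_mono_on (by linarith) (hInt _) (by simp) fun r hr => by
            have := half_le_psi (y := -(-(1 + B) + H r)) (by linarith [(abs_le.1 (hB r hr)).2])
            rw [psi_neg] at this
            linarith
      _ = -T := by simp; ring
      _ ≤ D := (abs_le.1 hD).1
  exact mem_range_of_exists_le_of_exists_ge hcont ⟨_, hdn⟩ ⟨_, hup⟩

/-- On each large symmetric interval a minimizer is a primitive of `psi (c + H)`, where `H` is a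
primitive of `a W'(u)`. -/
lemma exists_eq_add_integral_psi {a W u : ℝ → ℝ} {a₂ M T : ℝ} (hT : 2 ≤ T) (hW : DoubleWell W)
    (hma : Measurable a) (ha : ∀ t, 0 ≤ a t ∧ a t ≤ a₂) (hu : memX1 u) (hu1 : ∀ t, |u t| ≤ 1)
    (hfin : LaE a W u ≠ ⊤) (hmin : ∀ v, memX1 v → LaE a W u ≤ LaE a W v)
    (hM : ∀ t, |a t * deriv W (u t)| ≤ M) :
    ∃ c, ∀ t ∈ Icc (-T) T,
      u t = u (-T) + ∫ r in (-T)..t, psi (c + ∫ x in (0:ℝ)..r, a x * deriv W (u x)) := by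
  have huc := hu.1.continuous
  have hfm : Measurable fun t => a t * deriv W (u t) :=
    hma.mul ((hW.1.continuous_deriv le_rfl).comp huc).measurable
  have hfi : ∀ s t, IntervalIntegrable (fun t => a t * deriv W (u t)) volume s t :=
    intervalIntegrable_of_bdd hfm hM
  set H : ℝ → ℝ := fun r => ∫ x in (0:ℝ)..r, a x * deriv W (u x) with hHdef
  have hHc : Continuous H := intervalIntegral.continuous_primitive hfi 0
  obtain ⟨c, hc⟩ := exists_integral_psi_eq hHc (T := T) (D := u T - u (-T)) (by linarith)
    (by
      have h1 := abs_le.1 (hu1 T)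
      have h2 := abs_le.1 (hu1 (-T))
      exact abs_le.2 ⟨by linarith, by linarith⟩)
  have hψc : Continuous fun r => psi (c + H r) :=
    continuous_psi.comp (by fun_prop : Continuous fun r => c + H r)
  set w₀ : ℝ → ℝ := fun t => u (-T) + ∫ r in (-T)..t, psi (c + H r) with hw₀
  have hw₀d : ∀ t, HasDerivAt w₀ (psi (c + H t)) t := fun t =>
    (intervalIntegral.integral_hasDerivAt_right (hψc.intervalIntegrable _ _)
      (hψc.stronglyMeasurableAtFilter _ _) hψc.continuousAt).const_add _
  have hw₀L : LipschitzWith 1 w₀ :=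
    lipschitzWith_of_nnnorm_deriv_le (fun t => (hw₀d t).differentiableAt) fun t => by
      rw [(hw₀d t).deriv, ← NNReal.coe_le_coe]
      simpa using (abs_psi_lt_one (c + H t)).le
  have hw₀l : w₀ (-T) = u (-T) := by simp [hw₀]
  have hw₀r : w₀ T = u T := by simp [hw₀, hc]
  set w : ℝ → ℝ := fun t => if t ≤ -T then u t else (if t ≤ T then w₀ t else u t) with hw
  have hwL : LipschitzWith 1 w :=
    lipschitzWith_glue hu.1 (lipschitzWith_glue hw₀L hu.1 hw₀r)
      (by rw [if_pos (by linarith : -T ≤ T), hw₀l])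
  have hwu : ∀ t, t ∉ Icc (-T) T → w t = u t := by
    intro t ht
    by_cases h1 : t ≤ -T
    · exact if_pos h1
    · have h2 : ¬ t ≤ T := fun h2 => ht ⟨(not_le.1 h1).le, h2⟩
      simp [hw, h1, h2]
  have hwin : ∀ t ∈ Icc (-T) T, w t = w₀ t := by
    intro t ht
    rcases ht.1.eq_or_lt with h | h
    · rw [← h, hw₀l]
      exact if_pos le_rfl
    · simp [hw, not_le.2 h, ht.2]
  have hwd : ∀ t ∈ Ioo (-T) T, deriv w t = psi (c + H t) := by
    intro t ht
    have hev : w =ᶠ[𝓝 t] w₀ := by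
      filter_upwards [Ioo_mem_nhds ht.1 ht.2] with x hx using hwin x (Ioo_subset_Icc_self hx)
    rw [hev.deriv_eq, (hw₀d t).deriv]
  have hvar := variational_inequality (by linarith) hW hma ha hu hfin hmin hwL hwu
  have hAC : ∀ {f : ℝ → ℝ} {K : NNReal}, LipschitzWith K f →
      AbsolutelyContinuousOnInterval f (-T) T := fun hf =>
    (hf.lipschitzOnWith (s := uIcc (-T) T)).absolutelyContinuousOnInterval
  have hACy : AbsolutelyContinuousOnInterval (fun r => c + H r) (-T) T := by
    have h := ((hfi (-T) T).absolutelyContinuousOnInterval_intervalIntegral (c := 0)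
      (by rw [uIcc_of_le (by linarith)]; constructor <;> linarith))
    exact (hAC (LipschitzWith.const' (K := 1) c)).add h
  have hACd : AbsolutelyContinuousOnInterval (fun r => w r - u r) (-T) T :=
    (hAC hwL).sub (hAC hu.1)
  have hparts := hACy.integral_mul_deriv_eq_deriv_mul hACd
  have hwl : w (-T) - u (-T) = 0 := by
    rw [hwin _ ⟨le_rfl, by linarith⟩, hw₀l, sub_self]
  have hwr : w T - u T = 0 := by
    rw [hwin _ ⟨by linarith, le_rfl⟩, hw₀r, sub_self]
  rw [hwl, hwr] at hparts
  have hH' : ∫ r in (-T)..T, deriv (fun r => c + H r) r * (w r - u r)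
      = ∫ r in (-T)..T, a r * deriv W (u r) * (w r - u r) := by
    refine intervalIntegral.integral_congr_ae ?_
    filter_upwards [(hfi (-T) T).ae_hasDerivAt_integral] with r hr hrm
    rw [((hr (uIoc_subset_uIcc hrm) 0 (by
      rw [uIcc_of_le (by linarith)]; constructor <;> linarith)).const_add c).deriv]
  have hd' : ∫ r in (-T)..T, (c + H r) * deriv (fun r => w r - u r) r
      = ∫ r in (-T)..T, (c + H r) * (deriv w r - deriv u r) := by
    refine intervalIntegral.integral_congr_ae ?_
    filter_upwards [hu.1.ae_differentiableAt_real, hwL.ae_differentiableAt_real] with r h1 h2 _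
    rw [(h2.hasDerivAt.fun_sub h1.hasDerivAt).deriv]
  rw [hH', hd'] at hparts
  set E : ℝ → ℝ := fun r =>
    kin (deriv u r) - kin (psi (c + H r)) - (c + H r) * (deriv u r - psi (c + H r)) with hE
  have hE0 : ∀ r, 0 ≤ E r := fun r => kin_excess_nonneg (hu.1.abs_deriv_le_one r) _
  have hkd : IntervalIntegrable (fun r => kin (deriv w r) - kin (deriv u r)) volume (-T) T :=
    (intervalIntegrable_kin_deriv _ _ _).sub (intervalIntegrable_kin_deriv _ _ _)
  have hyd : IntervalIntegrable (fun r => (c + H r) * (deriv w r - deriv u r)) volume (-T) T :=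
    ((intervalIntegrable_deriv_of_lipschitz hwL _ _).sub
      (intervalIntegrable_deriv_of_lipschitz hu.1 _ _)).continuousOn_mul
      (by fun_prop : Continuous fun r => c + H r).continuousOn
  have hioo : ∀ᵐ r, r ∈ Ioc (-T) T → r ∈ Ioo (-T) T := by
    filter_upwards [(measure_eq_zero_iff_ae_notMem (μ := volume)).1
      (Real.volume_singleton (a := T))] with r hr hrm
    exact ⟨hrm.1, lt_of_le_of_ne hrm.2 hr⟩
  have hEeq : ∀ᵐ r, r ∈ Ioc (-T) T →
      E r = -((kin (deriv w r) - kin (deriv u r)) - (c + H r) * (deriv w r - deriv u r)) := by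
    filter_upwards [hioo] with r hr hrm
    rw [hwd r (hr hrm)]
    simp only [hE]
    ring
  have hTT : -T ≤ T := by linarith
  have hEint : IntervalIntegrable E volume (-T) T := by
    refine (hkd.sub hyd).neg.congr_ae ?_
    rw [uIoc_of_le hTT]
    filter_upwards [(ae_restrict_iff' measurableSet_Ioc).2 hEeq] with r hr using hr.symm
  have hEle : ∫ r in (-T)..T, E r ≤ 0 := by
    rw [intervalIntegral.integral_congr_ae (by rwa [uIoc_of_le hTT]),
      intervalIntegral.integral_neg, intervalIntegral.integral_sub hkd hyd]
    linarith
  have hEae : E =ᵐ[volume.restrict (Ioc (-T) T)] 0 :=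
    (intervalIntegral.integral_eq_zero_iff_of_le_of_nonneg_ae hTT
      (Eventually.of_forall hE0) hEint).1
      (le_antisymm hEle (intervalIntegral.integral_nonneg hTT fun r _ => hE0 r))
  have huψ : ∀ᵐ r, r ∈ Ioc (-T) T → deriv u r = psi (c + H r) := by
    filter_upwards [(ae_restrict_iff' measurableSet_Ioc).1 hEae] with r hr hrm
    exact eq_psi_of_kin_excess_eq_zero (hu.1.abs_deriv_le_one r) (hr hrm)
  refine ⟨c, fun t ht => ?_⟩
  have h1 : ∫ r in (-T)..t, psi (c + H r) = ∫ r in (-T)..t, deriv u r := by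
    refine intervalIntegral.integral_congr_ae ?_
    filter_upwards [huψ] with r hr hrm
    rw [uIoc_of_le ht.1] at hrm
    exact (hr ⟨hrm.1, hrm.2.trans ht.2⟩).symm
  rw [h1, integral_deriv_of_lipschitz hu.1]
  ring

/-- A minimizer solves the Euler–Lagrange equation, with derivative `psi` of the momentum. -/
lemma exists_deriv_eq_psi {a W u : ℝ → ℝ} {a₂ M : ℝ} (hW : DoubleWell W)
    (hma : Measurable a) (ha : ∀ t, 0 ≤ a t ∧ a t ≤ a₂) (hu : memX1 u) (hu1 : ∀ t, |u t| ≤ 1)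
    (hfin : LaE a W u ≠ ⊤) (hmin : ∀ v, memX1 v → LaE a W u ≤ LaE a W v)
    (hM : ∀ t, |a t * deriv W (u t)| ≤ M) (R : ℝ) :
    ∃ c, ∀ t, |t| < R →
      HasDerivAt u (psi (c + ∫ x in (0:ℝ)..t, a x * deriv W (u x))) t := by
  have hfm : Measurable fun t => a t * deriv W (u t) :=
    hma.mul ((hW.1.continuous_deriv le_rfl).comp hu.1.continuous).measurable
  have hHc : Continuous fun r => ∫ x in (0:ℝ)..r, a x * deriv W (u x) :=
    intervalIntegral.continuous_primitive (intervalIntegrable_of_bdd hfm hM) 0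
  obtain ⟨c, hc⟩ := exists_eq_add_integral_psi (le_max_right R 2) hW hma ha hu hu1 hfin hmin hM
  refine ⟨c, fun t ht => ?_⟩
  have hψc : Continuous fun r => psi (c + ∫ x in (0:ℝ)..r, a x * deriv W (u x)) :=
    continuous_psi.comp (continuous_const.add hHc)
  have h := (intervalIntegral.integral_hasDerivAt_right (hψc.intervalIntegrable (-max R 2) t)
      (hψc.stronglyMeasurableAtFilter _ _) hψc.continuousAt).const_add (u (-max R 2))
  refine h.congr_of_eventuallyEq ?_
  have ht' := abs_lt.1 (ht.trans_le (le_max_left R 2))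
  filter_upwards [Ioo_mem_nhds ht'.1 ht'.2] with x hx using hc x (Ioo_subset_Icc_self hx)

lemma solvesEL_of_minimizer {a W u : ℝ → ℝ} {a₂ M : ℝ} (hW : DoubleWell W)
    (hma : Measurable a) (ha : ∀ t, 0 ≤ a t ∧ a t ≤ a₂) (hu : memX1 u) (hu1 : ∀ t, |u t| ≤ 1)
    (hfin : LaE a W u ≠ ⊤) (hmin : ∀ v, memX1 v → LaE a W u ≤ LaE a W v)
    (hM : ∀ t, |a t * deriv W (u t)| ≤ M) :
    SolvesEL a W u ∧ ∀ t, ∃ y, deriv u t = psi y := by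
  have hder := exists_deriv_eq_psi hW hma ha hu hu1 hfin hmin hM
  have hfm : Measurable fun t => a t * deriv W (u t) :=
    hma.mul ((hW.1.continuous_deriv le_rfl).comp hu.1.continuous).measurable
  have hfi := intervalIntegrable_of_bdd hfm hM
  have hHc : Continuous fun r => ∫ x in (0:ℝ)..r, a x * deriv W (u x) :=
    intervalIntegral.continuous_primitive hfi 0
  refine ⟨⟨contDiff_one_iff_deriv.2 ⟨fun t => ?_, continuous_iff_continuousAt.2 fun t => ?_⟩,
    fun s t => ?_⟩, fun t => ?_⟩
  · obtain ⟨c, hc⟩ := hder (|t| + 1)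
    exact (hc t (by linarith)).differentiableAt
  · obtain ⟨c, hc⟩ := hder (|t| + 1)
    have hψc : Continuous fun r => psi (c + ∫ x in (0:ℝ)..r, a x * deriv W (u x)) :=
      continuous_psi.comp (continuous_const.add hHc)
    refine hψc.continuousAt.congr ?_
    filter_upwards [continuous_abs.continuousAt.eventually_lt continuousAt_const
      (by linarith : |t| < |t| + 1)] with x hx
    exact (hc x hx).deriv.symm
  · obtain ⟨c, hc⟩ := hder (|s| + |t| + 1)
    rw [(hc s (by linarith [abs_nonneg t])).deriv, (hc t (by linarith [abs_nonneg s])).deriv,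
      psi_div_sqrt, psi_div_sqrt, add_sub_add_left_eq_sub]
    exact intervalIntegral.integral_interval_sub_left (hfi _ _) (hfi _ _)
  · obtain ⟨c, hc⟩ := hder (|t| + 1)
    exact ⟨_, (hc t (by linarith)).deriv⟩

/-- If `u` and the force `a W'(u)` converge, to `x` and `0`, then `u'` tends to `0`. -/
lemma tendsto_deriv_zero_of_solvesEL {a W u : ℝ → ℝ} {l : Filter ℝ} {x : ℝ}
    (hEL : SolvesEL a W u) (hψ : ∀ t, ∃ y, deriv u t = psi y)
    (hl : Tendsto (fun t => t + 1) l l)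
    (hunif : ∀ P : ℝ → Prop, (∀ᶠ t in l, P t) → ∀ᶠ t in l, ∀ r ∈ Icc t (t + 1), P r)
    (hux : Tendsto u l (𝓝 x)) (hf : Tendsto (fun t => a t * deriv W (u t)) l (𝓝 0)) :
    Tendsto (deriv u) l (𝓝 0) := by
  have hdiff : Differentiable ℝ u := hEL.1.differentiable one_ne_zero
  have hp : Tendsto (fun t => u (t + 1) - u t) l (𝓝 0) := by
    simpa using (hux.comp hl).sub hux
  have hphi : Tendsto (fun t => (u (t + 1) - u t) / Real.sqrt (1 - (u (t + 1) - u t) ^ 2)) l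
      (𝓝 0) := by
    have h1 : ContinuousAt (fun p : ℝ => p / Real.sqrt (1 - p ^ 2)) 0 :=
      continuousAt_id.div (by fun_prop) (by simp)
    have h2 := h1.tendsto.comp hp
    simpa [Function.comp_def] using h2
  rw [Metric.tendsto_nhds]
  intro ε hε
  have hf' := hunif _ ((Metric.tendsto_nhds.1 hf) (ε / 2) (by linarith))
  filter_upwards [hf', (Metric.tendsto_nhds.1 hphi) (ε / 2) (by linarith)] with t hft hpt
  rw [dist_zero_right, Real.norm_eq_abs] at hpt ⊢
  obtain ⟨ξ, hξ, hξd⟩ := exists_deriv_eq_slope u (by linarith : t < t + 1)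
    hdiff.continuous.continuousOn hdiff.differentiableOn
  rw [add_sub_cancel_left, div_one] at hξd
  have h1 := hEL.2 t ξ
  rw [hξd] at h1
  have h2 : |∫ r in t..ξ, a r * deriv W (u r)| ≤ ε / 2 * |ξ - t| := by
    rw [← Real.norm_eq_abs]
    refine intervalIntegral.norm_integral_le_of_norm_le_const fun r hr => ?_
    rw [uIoc_of_le hξ.1.le] at hr
    simpa using (hft r ⟨hr.1.le, hr.2.trans hξ.2.le⟩).le
  have h3 : ε / 2 * |ξ - t| ≤ ε / 2 := by
    refine mul_le_of_le_one_right (by linarith) ?_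
    rw [abs_of_pos (by linarith [hξ.1])]
    linarith [hξ.2]
  obtain ⟨y, hy⟩ := hψ t
  rw [hy, psi_div_sqrt] at h1
  rw [hy]
  refine (abs_psi_le y).trans_lt ?_
  have h4 := abs_le.1 (h2.trans h3)
  have h5 := abs_lt.1 hpt
  exact abs_lt.2 ⟨by linarith, by linarith⟩

lemma DoubleWell.deriv_eq_zero {W : ℝ → ℝ} (hW : DoubleWell W) {s : ℝ} (hs : W s = 0) :
    deriv W s = 0 :=
  IsLocalMin.deriv_eq_zero (Eventually.of_forall fun x => by rw [hs]; exact hW.nonneg x)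

lemma tendsto_force_zero {a W u : ℝ → ℝ} {a₂ s : ℝ} {l : Filter ℝ} (hW : DoubleWell W)
    (ha : ∀ t, 0 ≤ a t ∧ a t ≤ a₂) (hs : W s = 0) (hu : Tendsto u l (𝓝 s)) :
    Tendsto (fun t => a t * deriv W (u t)) l (𝓝 0) := by
  have h : Tendsto (fun t => deriv W (u t)) l (𝓝 0) := by
    have := ((hW.1.continuous_deriv le_rfl).tendsto s).comp hu
    rwa [hW.deriv_eq_zero hs] at this
  refine bdd_le_mul_tendsto_zero' a₂ (Eventually.of_forall fun t => ?_) h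
  rw [abs_of_nonneg (ha t).1]
  exact (ha t).2

lemma exists_lt_one_forall_abs_le {f : ℝ → ℝ} (hf : Continuous f) (h1 : ∀ t, |f t| < 1)
    (htop : Tendsto f atTop (𝓝 0)) (hbot : Tendsto f atBot (𝓝 0)) :
    ∃ c < 1, ∀ t, |f t| ≤ c := by
  have habs : ∀ {l : Filter ℝ}, Tendsto f l (𝓝 0) → ∀ᶠ t in l, |f t| < 1 / 2 := fun h =>
    (by simpa using h.abs : Tendsto (fun t => |f t|) _ (𝓝 0)).eventually_lt_const (by norm_num)
  obtain ⟨q, hq⟩ := (habs htop).exists_forall_of_atTop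
  obtain ⟨p, hp⟩ := (habs hbot).exists_forall_of_atBot
  obtain ⟨x, -, hx⟩ := (isCompact_Icc (a := min p q) (b := max p q)).exists_isMaxOn
    (nonempty_Icc.2 min_le_max) hf.abs.continuousOn
  refine ⟨max (1 / 2) |f x|, max_lt (by norm_num) (h1 x), fun t => ?_⟩
  rcases le_total t p with h | h
  · exact (hp t h).le.trans (le_max_left _ _)
  rcases le_total q t with h' | h'
  · exact (hq t h').le.trans (le_max_left _ _)
  · exact (hx ⟨(min_le_left _ _).trans h, h'.trans (le_max_right _ _)⟩ : |f t| ≤ |f x|).trans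
      (le_max_right _ _)

/-- For a weight satisfying `(a₁)` with `a(t) → a₂` as `|t| → ∞`,
`L_a` attains its infimum at some `u_a ∈ X₁`, a `C¹ ∩ W^{2,2}_loc` heteroclinic solution
with `‖u'‖_{L^∞} < 1`. -/
theorem La_attains_infimum_asymptotically_constant (W a : ℝ → ℝ) (a₁ a₂ : ℝ)
    (hW : DoubleWell W) (hma : Measurable a)
    (ha₁ : 0 < a₁) (ha : ∀ t : ℝ, a₁ ≤ a t ∧ a t ≤ a₂)
    (hlimT : Tendsto a atTop (𝓝 a₂)) (hlimB : Tendsto a atBot (𝓝 a₂)) :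
    ∃ u : ℝ → ℝ, memX1 u ∧ (∀ v : ℝ → ℝ, memX1 v → LaE a W u ≤ LaE a W v) ∧
      SolvesEL a W u ∧
      Tendsto u atTop (𝓝 (1:ℝ)) ∧ Tendsto u atBot (𝓝 (-1:ℝ)) ∧
      Tendsto (deriv u) atTop (𝓝 (0:ℝ)) ∧ Tendsto (deriv u) atBot (𝓝 (0:ℝ)) ∧
      ∃ c : ℝ, c < 1 ∧ ∀ t : ℝ, |deriv u t| ≤ c := by
  have ha' : ∀ t, 0 ≤ a t ∧ a t ≤ a₂ := fun t => ⟨ha₁.le.trans (ha t).1, (ha t).2⟩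
  obtain ⟨u, hu, hu1, hfin, hmin⟩ := exists_minimizer hW hma ha₁ ha hlimT hlimB
  obtain ⟨B, hB⟩ := (isCompact_Icc (a := (-1:ℝ)) (b := 1)).exists_bound_of_continuousOn
    (hW.1.continuous_deriv le_rfl).continuousOn
  have hM : ∀ t, |a t * deriv W (u t)| ≤ a₂ * B := fun t => by
    rw [abs_mul, abs_of_nonneg (ha' t).1]
    exact mul_le_mul (ha' t).2 (hB _ (abs_le.1 (hu1 t))) (abs_nonneg _)
      ((ha' t).1.trans (ha' t).2)
  obtain ⟨hEL, hψ⟩ := solvesEL_of_minimizer hW hma ha' hu hu1 hfin hmin hM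
  have hdT : Tendsto (deriv u) atTop (𝓝 0) := by
    refine tendsto_deriv_zero_of_solvesEL hEL hψ (tendsto_atTop_add_const_right _ _ tendsto_id)
      (fun P hP => ?_) hu.2.1 (tendsto_force_zero hW ha' hW.2.2.1 hu.2.1)
    filter_upwards [eventually_forall_ge_atTop.2 hP] with t ht r hr using ht r hr.1
  have hdB : Tendsto (deriv u) atBot (𝓝 0) := by
    have hl : Tendsto (fun t : ℝ => t + 1) atBot atBot :=
      tendsto_atBot_add_const_right _ _ tendsto_id
    refine tendsto_deriv_zero_of_solvesEL hEL hψ hl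
      (fun P hP => ?_) hu.2.2 (tendsto_force_zero hW ha' hW.2.1 hu.2.2)
    filter_upwards [hl.eventually (eventually_forall_le_atBot.2 hP)] with t ht r hr using ht r hr.2
  refine ⟨u, hu, hmin, hEL, hu.2.1, hu.2.2, hdT, hdB,
    exists_lt_one_forall_abs_le (hEL.1.continuous_deriv le_rfl) (fun t => ?_) hdT hdB⟩
  obtain ⟨y, hy⟩ := hψ t
  rw [hy]
  exact abs_psi_lt_one y
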